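/- During the execution of the left-greedy algorithm on t stacks in series, any element all of whose smaller elements have already entered the stacks will be moved to the output before any new element enters the stacks; consequently, when comparing with the right-greedy algorithm at corresponding critical moments, no element leaves the stacks under the right-greedy algorithm that has not already left under the left-greedy algorithm. -/

import Mathlib

/-- A configuration for sorting with `t` stacks in series: the remaining input,
the stacks (index `0` is the leftmost, next to the output; index `t-1` is the
rightmost, next to the input; the head of each list is the top of the stack),
and the output produced so far. -/
structure Conf where
  input : List ℕ
  stks : List (List ℕ)
  output : List ℕ
deriving DecidableEq, Repr

/-- `x` may be placed on top of a stack iff the stack is empty or `x` is smaller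
than the current top (stacks are increasing from top to bottom). -/
def canPush (x : ℕ) : List ℕ → Bool
  | [] => true
  | y :: _ => decide (x < y)

/-- Moves, ordered left to right: `0` = pop the leftmost stack to the output
(legal only for the next element of the identity); `m` with `0 < m < t` = move the
top of stack `m` one stack to the left; `t` = push the next input element onto the
rightmost stack. -/
def legal (t : ℕ) (c : Conf) (m : ℕ) : Bool :=
  if m = 0 then
    match c.stks.getD 0 [] with
    | x :: _ => x == c.output.length + 1
    | [] => false
  else if m < t then
    match c.stks.getD m [] with
    | x :: _ => canPush x (c.stks.getD (m-1) [])
    | [] => false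
  else if m = t then
    match c.input with
    | x :: _ => canPush x (c.stks.getD (t-1) [])
    | [] => false
  else false

/-- Perform move `m` on configuration `c` (with `t` stacks). -/
def applyMove (t : ℕ) (c : Conf) (m : ℕ) : Conf :=
  if m = 0 then
    match c.stks.getD 0 [] with
    | x :: s => ⟨c.input, c.stks.set 0 s, c.output ++ [x]⟩
    | [] => c
  else if m < t then
    match c.stks.getD m [] with
    | x :: s => ⟨c.input, (c.stks.set m s).set (m-1) (x :: c.stks.getD (m-1) []), c.output⟩
    | [] => c
  else
    match c.input with
    | x :: rest => ⟨rest, c.stks.set (t-1) (x :: c.stks.getD (t-1) []), c.output⟩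
    | [] => c

def initConf (t : ℕ) (p : List ℕ) : Conf := ⟨p, List.replicate t [], []⟩

/-- The fully sorted configuration: empty input and stacks, output `1,2,...,n`. -/
def finalConf (t n : ℕ) : Conf := ⟨[], List.replicate t [], List.range' 1 n⟩

/-- Run a sequence of moves, requiring each to be legal. -/
def runLegal (t : ℕ) : Conf → List ℕ → Option Conf
  | c, [] => some c
  | c, m :: ms => if legal t c m then runLegal t (applyMove t c m) ms else none

/-- `p` is sortable by `t` stacks in series by some sequence of legal moves. -/
def Sortable (t : ℕ) (p : List ℕ) : Prop :=
  ∃ ms : List ℕ, runLegal t (initConf t p) ms = some (finalConf t p.length)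

/-- The leftmost legal move, if any. -/
def leftMove (t : ℕ) (c : Conf) : Option ℕ :=
  ((List.range (t+1)).filter (fun m => legal t c m)).head?

/-- The rightmost legal move, if any. -/
def rightMove (t : ℕ) (c : Conf) : Option ℕ :=
  ((List.range (t+1)).filter (fun m => legal t c m)).getLast?

/-- One step of a greedy algorithm given by the move selector `mv`
(the configuration is unchanged if no move is legal, i.e. the algorithm fails or is done). -/
def greedyStep (mv : ℕ → Conf → Option ℕ) (t : ℕ) (c : Conf) : Conf :=
  match mv t c with
  | some m => applyMove t c m
  | none => c

/-- The greedy algorithm given by `mv` sorts `p` with `t` stacks in series. -/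
def GreedySorts (mv : ℕ → Conf → Option ℕ) (t : ℕ) (p : List ℕ) : Prop :=
  ∃ k : ℕ, (greedyStep mv t)^[k] (initConf t p) = finalConf t p.length

def LeftGreedySorts : ℕ → List ℕ → Prop := GreedySorts leftMove
def RightGreedySorts : ℕ → List ℕ → Prop := GreedySorts rightMove

/-- `p` is a permutation of `1,...,n` (as a list). -/
def IsPermOf (n : ℕ) (p : List ℕ) : Prop := p.Perm (List.range' 1 n)

/-- The position of the element `x` in configuration `c`: `0` if in the output
(furthest left), `j+1` if in stack `j`, `t+1` if still in the input (furthest right). -/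
def posOf (t : ℕ) (c : Conf) (x : ℕ) : ℕ :=
  if x ∈ c.output then 0
  else match (List.range t).find? (fun j => decide (x ∈ c.stks.getD j [])) with
    | some j => j + 1
    | none => t + 1

/-- `c` is at the `i`-th critical moment for the greedy algorithm `mv` on a
permutation of length `n`: either the chosen move is the entry of the `i`-th
element into the stacks, or the algorithm fails (no legal move, incomplete output). -/
def IsCrit (mv : ℕ → Conf → Option ℕ) (t i n : ℕ) (c : Conf) : Prop :=
  (c.input.length + i = n + 1 ∧ mv t c = some t) ∨
  (mv t c = none ∧ c.output.length < n)

/-- `c` is the configuration at the `i`-th critical moment of the greedy algorithm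
`mv` run on `p` (the first moment along the run satisfying `IsCrit`). -/
def CritConf (mv : ℕ → Conf → Option ℕ) (t i n : ℕ) (p : List ℕ) (c : Conf) : Prop :=
  ∃ k : ℕ, (greedyStep mv t)^[k] (initConf t p) = c ∧ IsCrit mv t i n c ∧
    ∀ k' < k, ¬ IsCrit mv t i n ((greedyStep mv t)^[k'] (initConf t p))

/-- No stack is empty while some stack to its right is nonempty. -/
def NoGap (t : ℕ) (c : Conf) : Prop :=
  ∀ j j' : ℕ, j < j' → j' < t → c.stks.getD j' [] ≠ [] → c.stks.getD j [] ≠ []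

/-- `r` contains `q` as a pattern. -/
def ContainsPat (r q : List ℕ) : Prop :=
  ∃ f : Fin q.length → Fin r.length, StrictMono f ∧
    ∀ a b : Fin q.length, q.get a < q.get b ↔ r.get (f a) < r.get (f b)

/-- `f` is the position function of the configuration `c`, reached while sorting the
permutation `p` of `1,...,n`: `f x` is `0` for `x` in the output, `j + 1` for `x` in stack `j`,
and `t + 1` for `x` in the input. -/
structure HasPos (t n : ℕ) (p : List ℕ) (c : Conf) (f : ℕ → ℕ) : Prop where
  perm : IsPermOf n p
  len : c.stks.length = t
  sorted : ∀ j, (c.stks.getD j []).Pairwise (· < ·)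
  out : c.output = List.range' 1 c.output.length
  suffix : c.input <:+ p
  mem_out : ∀ x, x ∈ c.output ↔ x ∈ p ∧ f x = 0
  mem_stk : ∀ j < t, ∀ x, x ∈ c.stks.getD j [] ↔ x ∈ p ∧ f x = j + 1
  mem_in : ∀ x, x ∈ c.input ↔ x ∈ p ∧ f x = t + 1
  le : ∀ x, f x ≤ t + 1

/-- In a configuration with positions `f`, the element `x` may leave stack `m`: it is the top of
that stack, and it may be placed on stack `m - 1` (or output, if `m = 0`). -/
structure CanMove (p : List ℕ) (f : ℕ → ℕ) (m x : ℕ) : Prop where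
  mem : x ∈ p
  pos : f x = m + 1
  top : ∀ y ∈ p, f y = m + 1 → x ≤ y
  push : 0 < m → ∀ y ∈ p, f y = m → x < y
  output : m = 0 → ∀ y ∈ p, y < x → f y = 0

theorem List.getD_set_nil {α : Type*} (l : List (List α)) (i j : ℕ) (a : List α) :
    (l.set i a).getD j [] = if i = j ∧ i < l.length then a else l.getD j [] := by
  grind

theorem IsPermOf.mem_iff {n : ℕ} {p : List ℕ} (h : IsPermOf n p) (x : ℕ) :
    x ∈ p ↔ 1 ≤ x ∧ x ≤ n := by
  rw [List.Perm.mem_iff h, List.mem_range'_1]; omega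

theorem IsPermOf.nodup {n : ℕ} {p : List ℕ} (h : IsPermOf n p) : p.Nodup :=
  (List.Perm.nodup_iff h).2 List.nodup_range'

theorem canPush_iff {x : ℕ} {s : List ℕ} (hs : s.Pairwise (· < ·)) :
    canPush x s = true ↔ ∀ y ∈ s, x < y := by
  cases s with
  | nil => simp [canPush]
  | cons a s =>
    simp only [canPush, decide_eq_true_eq, List.mem_cons, forall_eq_or_imp]
    exact ⟨fun h => ⟨h, fun y hy => h.trans (List.rel_of_pairwise_cons hs hy)⟩, fun h => h.1⟩

namespace HasPos

variable {t n : ℕ} {p : List ℕ} {c : Conf} {f : ℕ → ℕ}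

theorem initConf (hp : IsPermOf n p) : HasPos t n p (_root_.initConf t p) (fun _ => t + 1) where
  perm := hp
  len := by simp [_root_.initConf]
  sorted j := by
    have : (List.replicate t ([] : List ℕ)).getD j [] = [] := by grind
    simp only [_root_.initConf, this, List.Pairwise.nil]
  out := by simp [_root_.initConf]
  suffix := by simp [_root_.initConf]
  mem_out x := by simp [_root_.initConf]
  mem_stk j hj x := by
    have : (List.replicate t ([] : List ℕ)).getD j [] = [] := by grind
    simp only [_root_.initConf, this, List.not_mem_nil, false_iff]
    omega
  mem_in x := by simp [_root_.initConf]
  le x := le_rfl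

theorem unique {g : ℕ → ℕ} (hf : HasPos t n p c f) (hg : HasPos t n p c g) :
    ∀ x ∈ p, f x = g x := by
  intro x hx
  have h1 := hf.mem_out x
  have h2 := hg.mem_out x
  have h3 := hf.mem_in x
  have h4 := hg.mem_in x
  have h5 := hf.le x
  have h6 := hf.mem_stk (f x - 1)
  have h7 := hg.mem_stk (f x - 1)
  grind

theorem next_iff (h : HasPos t n p c f) {x : ℕ} (hx : x ∈ p) (h0 : f x ≠ 0) :
    x = c.output.length + 1 ↔ ∀ y ∈ p, y < x → f y = 0 := by
  have hmem : ∀ y, (y ∈ p ∧ f y = 0) ↔ 1 ≤ y ∧ y < 1 + c.output.length := by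
    intro y
    rw [← h.mem_out, h.out, List.mem_range'_1, List.length_range']
  have hp := h.perm.mem_iff
  constructor
  · intro he y hy hlt
    exact ((hmem y).2 ⟨((hp y).1 hy).1, by omega⟩).2
  · intro hall
    by_contra hne
    have h1 := hmem x
    have h2 := hmem (c.output.length + 1)
    have h3 := hall (c.output.length + 1)
    have h4 := hp (c.output.length + 1)
    have h5 := hp x
    grind

theorem top_iff (h : HasPos t n p c f) {m x : ℕ} (hm : m < t) :
    (x ∈ p ∧ f x = m + 1 ∧ ∀ y ∈ p, f y = m + 1 → x ≤ y) ↔ ∃ s, c.stks.getD m [] = x :: s := by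
  have hmem := h.mem_stk m hm
  have hs := h.sorted m
  generalize c.stks.getD m [] = l at hmem hs
  cases l with
  | nil => grind
  | cons a s =>
    rw [List.pairwise_cons] at hs
    have ha := (hmem a).1 List.mem_cons_self
    grind

theorem legal_iff (h : HasPos t n p c f) {m : ℕ} (hm : m < t) :
    legal t c m = true ↔ ∃ x, CanMove p f m x := by
  have key := fun x => h.top_iff hm (x := x)
  have hpush : ∀ x, 0 < m → (canPush x (c.stks.getD (m - 1) []) = true ↔
      ∀ y ∈ p, f y = m → x < y) := by
    intro x h0
    rw [canPush_iff (h.sorted _)]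
    have := h.mem_stk (m - 1) (by omega)
    grind
  have hcan : ∀ x, CanMove p f m x ↔ (∃ s, c.stks.getD m [] = x :: s) ∧
      (0 < m → canPush x (c.stks.getD (m - 1) []) = true) ∧
      (m = 0 → x = c.output.length + 1) := by
    intro x
    constructor
    · intro hx
      refine ⟨(key x).1 ⟨hx.mem, hx.pos, hx.top⟩, fun h0 => (hpush x h0).2 (hx.push h0),
        fun h0 => ?_⟩
      exact (h.next_iff hx.mem (by have := hx.pos; omega)).2 (hx.output h0)
    · rintro ⟨h1, h2, h3⟩
      obtain ⟨a1, a2, a3⟩ := (key x).2 h1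
      exact ⟨a1, a2, a3, fun h0 => (hpush x h0).1 (h2 h0),
        fun h0 => (h.next_iff a1 (by omega)).1 (h3 h0)⟩
  simp only [hcan]
  unfold legal
  split_ifs with h0
  · subst h0
    split <;> simp_all
  · split <;> simp_all [Nat.pos_of_ne_zero h0]

theorem legal_input_iff (h : HasPos t n p c f) (ht : 0 < t) :
    legal t c t = true ↔ ∃ x s, c.input = x :: s ∧ ∀ y ∈ p, f y = t → x < y := by
  have hpush : ∀ x, (canPush x (c.stks.getD (t - 1) []) = true ↔ ∀ y ∈ p, f y = t → x < y) := by
    intro x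
    rw [canPush_iff (h.sorted _)]
    have := h.mem_stk (t - 1) (by omega)
    grind
  unfold legal
  rw [if_neg (by omega), if_neg (by omega), if_pos rfl]
  split <;> simp_all

theorem applyMove_of_lt (h : HasPos t n p c f) {m x : ℕ} (hm : m < t) (hx : CanMove p f m x) :
    HasPos t n p (applyMove t c m) (Function.update f x m) ∧
      (applyMove t c m).input = c.input := by
  obtain ⟨s, hs⟩ := (h.top_iff hm).1 ⟨hx.mem, hx.pos, hx.top⟩
  have hlen := h.len
  have hsort := h.sorted m
  have hmem := h.mem_stk m hm
  have hpos := hx.pos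
  rw [hs, List.pairwise_cons] at hsort
  rw [hs] at hmem
  have hmem' : ∀ y, y ∈ s ↔ y ∈ p ∧ f y = m + 1 ∧ y ≠ x := by
    intro y
    have h1 := hmem y
    have h2 := hsort.1 y
    grind
  rcases Nat.eq_zero_or_pos m with rfl | h0
  · have hc : applyMove t c 0 = ⟨c.input, c.stks.set 0 s, c.output ++ [x]⟩ := by
      simp [applyMove, -List.getD_eq_getElem?_getD, hs]
    rw [hc]
    refine ⟨⟨h.perm, by simpa using hlen, ?_, ?_, h.suffix, ?_, ?_, ?_, ?_⟩, rfl⟩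
    · intro j
      simp only [List.getD_set_nil]
      split_ifs
      exacts [hsort.2, h.sorted j]
    · have := (h.next_iff hx.mem (by omega)).2 (hx.output rfl)
      have ho := h.out
      simp only [List.length_append, List.length_singleton]
      rw [← List.range'_append_1, ← ho, this, Nat.add_comm]
      rfl
    · intro y
      have := h.mem_out y
      have := hx.mem
      simp only [List.mem_append, List.mem_singleton, Function.update_apply]
      grind
    · intro j hj y
      have := h.mem_stk j hj y
      have := hmem' y
      simp only [List.getD_set_nil, Function.update_apply]
      grind
    · intro y
      have := h.mem_in y
      simp only [Function.update_apply]
      grind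
    · intro y
      have := h.le y
      simp only [Function.update_apply]
      grind
  · have hc : applyMove t c m = ⟨c.input,
        (c.stks.set m s).set (m - 1) (x :: c.stks.getD (m - 1) []), c.output⟩ := by
      simp [applyMove, -List.getD_eq_getElem?_getD, hs, h0.ne', hm]
    have hprev := h.mem_stk (m - 1) (by omega)
    rw [hc]
    refine ⟨⟨h.perm, by simpa using hlen, ?_, h.out, h.suffix, ?_, ?_, ?_, ?_⟩, rfl⟩
    · intro j
      simp only [List.getD_set_nil]
      split_ifs
      · refine List.pairwise_cons.2 ⟨fun y hy => ?_, h.sorted _⟩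
        have := (hprev y).1 hy
        exact hx.push h0 y this.1 (by omega)
      exacts [hsort.2, h.sorted j]
    · intro y
      have := h.mem_out y
      simp only [Function.update_apply]
      grind
    · intro j hj y
      have h1 := h.mem_stk j hj y
      have h2 := hmem' y
      have h3 := hprev y
      have h4 := hx.mem
      simp only [List.getD_set_nil, Function.update_apply, List.length_set]
      clear hmem hmem' hprev hsort hs hc
      split_ifs <;> grind
    · intro y
      have := h.mem_in y
      simp only [Function.update_apply]
      grind
    · intro y
      have := h.le y
      simp only [Function.update_apply]
      grind

theorem applyMove_input (h : HasPos t n p c f) (ht : 0 < t) {x : ℕ} {s : List ℕ}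
    (hx : c.input = x :: s) (hpush : ∀ y ∈ p, f y = t → x < y) :
    HasPos t n p (applyMove t c t) (Function.update f x t) ∧ (applyMove t c t).input = s := by
  have hlen := h.len
  have hc : applyMove t c t = ⟨s, c.stks.set (t - 1) (x :: c.stks.getD (t - 1) []), c.output⟩ := by
    simp [applyMove, -List.getD_eq_getElem?_getD, hx, ht.ne']
  have hprev := h.mem_stk (t - 1) (by omega)
  have hsuf := h.suffix
  have hnd := hsuf.sublist.nodup h.perm.nodup
  have hmem := h.mem_in
  rw [hx] at hsuf hnd hmem
  have hxp := (hmem x).1 List.mem_cons_self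
  rw [hc]
  refine ⟨⟨h.perm, by simpa using hlen, ?_, h.out, (List.suffix_cons x s).trans hsuf,
    ?_, ?_, ?_, ?_⟩, rfl⟩
  · intro j
    simp only [List.getD_set_nil]
    split_ifs
    · refine List.pairwise_cons.2 ⟨fun y hy => ?_, h.sorted _⟩
      have := (hprev y).1 hy
      exact hpush y this.1 (by omega)
    · exact h.sorted j
  · intro y
    have := h.mem_out y
    simp only [Function.update_apply]
    grind
  · intro j hj y
    have h1 := h.mem_stk j hj y
    have h3 := hprev y
    simp only [List.getD_set_nil, Function.update_apply]
    clear hmem hprev hnd hsuf hc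
    split_ifs <;> grind
  · intro y
    have := hmem y
    simp only [Function.update_apply]
    grind
  · intro y
    have := h.le y
    simp only [Function.update_apply]
    grind

theorem pos_of_legal (h : HasPos t n p c f) {m : ℕ} (hm : m ≤ t) (hl : legal t c m = true) :
    0 < t := by
  rcases Nat.eq_zero_or_pos t with rfl | ht
  · obtain rfl : m = 0 := by omega
    simp [legal, List.eq_nil_of_length_eq_zero h.len] at hl
  · exact ht

theorem exists_applyMove (h : HasPos t n p c f) {m : ℕ} (hm : m ≤ t) (hl : legal t c m = true) :
    ∃ f', HasPos t n p (applyMove t c m) f' ∧ ∀ x, f' x ≤ f x := by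
  rcases hm.lt_or_eq with hlt | rfl
  · obtain ⟨x, hx⟩ := (h.legal_iff hlt).1 hl
    refine ⟨_, (h.applyMove_of_lt hlt hx).1, fun y => ?_⟩
    have := hx.pos
    simp only [Function.update_apply]
    grind
  · have ht := h.pos_of_legal le_rfl hl
    obtain ⟨x, s, hx, hpush⟩ := (h.legal_input_iff ht).1 hl
    refine ⟨_, (h.applyMove_input ht hx hpush).1, fun y => ?_⟩
    have := (h.mem_in x).1 (by simp [hx])
    simp only [Function.update_apply]
    grind

/-- If `y` lies right of position `b` and nothing at `b` blocks it, then some element lying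
between `b` and the input can move. -/
theorem exists_legal (h : HasPos t n p c f) {b y : ℕ} (hy : y ∈ p) (hb : b < f y) (hyt : f y ≤ t)
    (hpush : 0 < b → ∀ z ∈ p, f z = b → y < z) (hout : b = 0 → ∀ z ∈ p, z < y → f z ≤ t) :
    ∃ m, b ≤ m ∧ m < t ∧ legal t c m = true := by
  classical
  have hex : ∃ z, z ∈ p ∧ b < f z ∧ f z ≤ t := ⟨y, hy, hb, hyt⟩
  obtain ⟨hz, hbz, hzt⟩ := Nat.find_spec hex
  have hmin : ∀ w ∈ p, b < f w → f w ≤ t → Nat.find hex ≤ w :=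
    fun w h1 h2 h3 => Nat.find_min' hex ⟨h1, h2, h3⟩
  have hzy := hmin y hy hb hyt
  generalize Nat.find hex = z at *
  refine ⟨f z - 1, by omega, by omega, (h.legal_iff (by omega)).2 ⟨z, hz, by omega, ?_, ?_, ?_⟩⟩
  · intro w hw hfw
    exact hmin w hw (by omega) (by omega)
  · intro h0 w hw hfw
    rcases Nat.lt_or_ge b (f w) with h1 | h1
    · have := hmin w hw h1 (by omega)
      have : z ≠ w := by rintro rfl; omega
      omega
    · have := hpush (by omega) w hw (by omega)
      omega
  · intro h0 w hw hlt
    have hb0 : b = 0 := by omega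
    have := hout hb0 w hw (by omega)
    by_contra hne
    have := hmin w hw (by omega) this
    omega

end HasPos

theorem leftMove_eq_some {t m : ℕ} {c : Conf} (h : leftMove t c = some m) :
    m ≤ t ∧ legal t c m = true ∧ ∀ m' < m, legal t c m' = false := by
  rw [leftMove, List.head?_filter, List.find?_range_eq_some] at h
  obtain ⟨h1, h2, h3⟩ := h
  exact ⟨by simpa [Nat.lt_succ_iff] using h2, h1, fun m' hm' => by simpa using h3 m' hm'⟩

theorem leftMove_eq_none {t m : ℕ} {c : Conf} (h : leftMove t c = none) (hm : m ≤ t) :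
    legal t c m = false := by
  rw [leftMove, List.head?_eq_none_iff, List.filter_eq_nil_iff] at h
  simpa using h m (by simp; omega)

theorem rightMove_eq_some {t m : ℕ} {c : Conf} (h : rightMove t c = some m) :
    m ≤ t ∧ legal t c m = true ∧ ∀ m', m < m' → m' ≤ t → legal t c m' = false := by
  have hmem := List.mem_of_getLast? h
  rw [List.mem_filter, List.mem_range, Nat.lt_succ_iff] at hmem
  refine ⟨hmem.1, hmem.2, fun m' hlt hle => ?_⟩
  by_contra hl
  have hm' : m' ∈ (List.range (t + 1)).filter (fun m => legal t c m) := by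
    rw [List.mem_filter, List.mem_range]
    exact ⟨by omega, by simpa using hl⟩
  have hs : ((List.range (t + 1)).filter (fun m => legal t c m)).Pairwise (· < ·) :=
    List.Pairwise.filter _ List.pairwise_lt_range
  obtain ⟨l, hl'⟩ := List.getLast?_eq_some_iff.1 h
  rw [hl'] at hm' hs
  rw [List.pairwise_append] at hs
  rcases List.mem_append.1 hm' with h1 | h1
  · have := hs.2.2 m' h1 m (List.mem_singleton_self m)
    omega
  · have := List.mem_singleton.1 h1
    omega

/-- The selector `mv` only selects legal moves. -/
def SelectsLegal (mv : ℕ → Conf → Option ℕ) : Prop :=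
  ∀ t c m, mv t c = some m → m ≤ t ∧ legal t c m = true

theorem selectsLegal_leftMove : SelectsLegal leftMove :=
  fun _ _ _ h => ⟨(leftMove_eq_some h).1, (leftMove_eq_some h).2.1⟩

theorem selectsLegal_rightMove : SelectsLegal rightMove :=
  fun _ _ _ h => ⟨(rightMove_eq_some h).1, (rightMove_eq_some h).2.1⟩

namespace SelectsLegal

variable {mv : ℕ → Conf → Option ℕ} {t n : ℕ} {p : List ℕ}

theorem exists_hasPos_iterate (hmv : SelectsLegal mv) {c : Conf} {f : ℕ → ℕ}
    (h : HasPos t n p c f) (k : ℕ) :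
    ∃ f', HasPos t n p ((greedyStep mv t)^[k] c) f' ∧ ∀ x, f' x ≤ f x := by
  induction k with
  | zero => exact ⟨f, h, fun _ => le_rfl⟩
  | succ k ih =>
    obtain ⟨f₁, h₁, hle⟩ := ih
    rw [Function.iterate_succ_apply']
    generalize (greedyStep mv t)^[k] c = d at h₁
    unfold greedyStep
    split
    · rename_i m hm
      obtain ⟨f₂, h₂, hle₂⟩ := h₁.exists_applyMove (hmv _ _ _ hm).1 (hmv _ _ _ hm).2
      exact ⟨f₂, h₂, fun x => (hle₂ x).trans (hle x)⟩
    · exact ⟨f₁, h₁, hle⟩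

theorem greedyStep_input (hmv : SelectsLegal mv) (c : Conf) :
    (greedyStep mv t c).input.length = c.input.length ∨
      mv t c = some t ∧ c.input.length = (greedyStep mv t c).input.length + 1 := by
  unfold greedyStep
  split
  · rename_i m hm
    have := (hmv _ _ _ hm).1
    unfold applyMove
    split_ifs with h0 hlt
    · left; split <;> rfl
    · left; split <;> rfl
    · obtain rfl : m = t := by omega
      split
      · rename_i hx
        exact Or.inr ⟨hm, by simp [hx]⟩
      · exact Or.inl rfl
  · exact Or.inl rfl

/-- Elements enter the stacks one at a time. -/
theorem exists_entry (hmv : SelectsLegal mv) {c : Conf} {a K : ℕ} (ha : a ≤ c.input.length)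
    (hK : ((greedyStep mv t)^[K] c).input.length < a) :
    ∃ k < K, ((greedyStep mv t)^[k] c).input.length = a ∧
      mv t ((greedyStep mv t)^[k] c) = some t := by
  induction K with
  | zero => exact absurd hK (by simpa using ha)
  | succ K ih =>
    by_cases h : ((greedyStep mv t)^[K] c).input.length < a
    · obtain ⟨k, hk, h'⟩ := ih h
      exact ⟨k, by omega, h'⟩
    · rw [Function.iterate_succ_apply'] at hK
      rcases hmv.greedyStep_input (t := t) ((greedyStep mv t)^[K] c) with h1 | ⟨h1, h2⟩
      · omega
      · exact ⟨K, by omega, by omega, h1⟩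

end SelectsLegal

/-- If no element of `l` can move left, the positions in `r` are weakly to the right of those in
`l`, and both configurations have the same input, then right-greedy on `r` moves no element past
its position in `l`. -/
theorem HasPos.le_of_rightMove {t n : ℕ} {p : List ℕ} {l r : Conf} {f g : ℕ → ℕ}
    (hl : HasPos t n p l f) (hr : HasPos t n p r g) (hstuck : ∀ m < t, legal t l m = false)
    (hin : l.input = r.input) (hle : ∀ x ∈ p, f x ≤ g x) {m x : ℕ}
    (hmove : rightMove t r = some m) (hm : m < t) (hx : CanMove p g m x) : f x ≤ m := by
  by_contra hlt
  have hxm : f x = m + 1 := by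
    have := hle x hx.mem
    have := hx.pos
    omega
  obtain ⟨-, -, hright⟩ := rightMove_eq_some hmove
  have hblock : ∀ y ∈ p, y < x → m + 1 < g y → f y ≤ t → False := by
    intro y hy hyx hgy hfy
    have hgt : g y ≤ t := by
      have h1 := hl.mem_in y
      have h2 := hr.mem_in y
      have h3 := hr.le y
      rw [hin] at h1
      grind
    obtain ⟨m', h1, h2, h3⟩ := hr.exists_legal hy hgy hgt
      (fun _ z hz hgz => hyx.trans_le (hx.top z hz hgz)) (by omega)
    simp [hright m' (by omega) h2.le] at h3
  have hno : ¬ CanMove p f m x := fun h => by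
    have := (hl.legal_iff hm).2 ⟨x, h⟩
    simp [hstuck m hm] at this
  refine hno ⟨hx.mem, hxm, fun y hy hfy => ?_, fun h0 y hy hfy => ?_, fun h0 y hy hyx => ?_⟩
  · by_contra hyx
    have h1 := hle y hy
    have h2 := hx.top y hy
    exact hblock y hy (by omega) (by omega) (by omega)
  · by_contra hyx
    have h1 := hle y hy
    have h2 := hx.top y hy
    have h3 := hx.push h0 y hy
    have hne : y ≠ x := by rintro rfl; omega
    exact hblock y hy (by omega) (by omega) (by omega)
  · have := hx.output h0 y hy hyx
    have := hle y hy
    omega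

theorem HasPos.input_suffix {t n : ℕ} {p : List ℕ} {l r : Conf} {f g : ℕ → ℕ}
    (hl : HasPos t n p l f) (hr : HasPos t n p r g)
    (h : l.input.length ≤ r.input.length) : l.input <:+ r.input :=
  List.suffix_of_suffix_length_le hl.suffix hr.suffix h

section Comparison

variable {t n : ℕ} {p : List ℕ}

/-- Whenever left-greedy cannot move any element in the stacks, and right-greedy has let at most
as many elements enter, every element is weakly further left under left-greedy. -/
theorem leftGreedy_pos_le (hp : IsPermOf n p) (k : ℕ) :
    ∀ K, (∀ m < t, legal t ((greedyStep leftMove t)^[K] (initConf t p)) m = false) →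
      ((greedyStep leftMove t)^[K] (initConf t p)).input.length ≤
        ((greedyStep rightMove t)^[k] (initConf t p)).input.length →
      ∀ f g, HasPos t n p ((greedyStep leftMove t)^[K] (initConf t p)) f →
        HasPos t n p ((greedyStep rightMove t)^[k] (initConf t p)) g →
        ∀ x ∈ p, f x ≤ g x := by
  induction k with
  | zero =>
    intro K _ _ f g hf hg x hx
    rw [← (HasPos.initConf hp).unique hg x hx]
    exact hf.le x
  | succ k ih =>
    intro K hstuck hlen f g hf hg y hy
    obtain ⟨g₀, hg₀, -⟩ := selectsLegal_rightMove.exists_hasPos_iterate (HasPos.initConf (t := t) hp) k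
    rw [Function.iterate_succ_apply'] at hlen hg
    generalize hr : (greedyStep rightMove t)^[k] (initConf t p) = r at *
    cases hmove : rightMove t r with
    | none =>
      simp only [greedyStep, hmove] at hlen hg
      exact ih K hstuck hlen f g hf hg y hy
    | some m =>
      simp only [greedyStep, hmove] at hlen hg
      obtain ⟨hmt, hlegal, -⟩ := rightMove_eq_some hmove
      rcases hmt.lt_or_eq with hm | rfl
      · obtain ⟨x, hx⟩ := (hg₀.legal_iff hm).1 hlegal
        obtain ⟨h₁, hin⟩ := hg₀.applyMove_of_lt hm hx
        rw [hin] at hlen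
        rw [← h₁.unique hg y hy, Function.update_apply]
        split_ifs with hyx
        · subst hyx
          rcases hlen.lt_or_eq with hlt | heq
          · obtain ⟨K', hK', hlen', hleft⟩ := selectsLegal_leftMove.exists_entry
              hg₀.suffix.length_le hlt
            obtain ⟨f', hf', -⟩ :=
              selectsLegal_leftMove.exists_hasPos_iterate (HasPos.initConf (t := t) hp) K'
            obtain ⟨f'', hf'', hle⟩ :=
              selectsLegal_leftMove.exists_hasPos_iterate hf' (K - K')
            rw [← Function.iterate_add_apply, Nat.sub_add_cancel hK'.le] at hf''
            have hstuck' := (leftMove_eq_some hleft).2.2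
            rw [hf.unique hf'' y hy]
            exact (hle y).trans (hf'.le_of_rightMove hg₀ hstuck'
              ((hf'.input_suffix hg₀ hlen'.le).eq_of_length hlen')
              (ih K' hstuck' hlen'.le f' g₀ hf' hg₀) hmove hm hx)
          · exact hf.le_of_rightMove hg₀ hstuck ((hf.input_suffix hg₀ hlen).eq_of_length heq)
              (ih K hstuck hlen f g₀ hf hg₀) hmove hm hx
        · exact ih K hstuck hlen f g₀ hf hg₀ y hy
      · have ht := hg₀.pos_of_legal le_rfl hlegal
        obtain ⟨x, s, hx, hpush⟩ := (hg₀.legal_input_iff ht).1 hlegal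
        obtain ⟨h₁, hin⟩ := hg₀.applyMove_input ht hx hpush
        have hsuf := hf.input_suffix h₁ hlen
        rw [hin] at hlen hsuf
        rw [← h₁.unique hg y hy, Function.update_apply]
        split_ifs with hyx
        · subst hyx
          have hnd := hg₀.suffix.sublist.nodup hp.nodup
          rw [hx, List.nodup_cons] at hnd
          have h2 : y ∉ ((greedyStep leftMove m)^[K] (initConf m p)).input :=
            fun h => hnd.1 (hsuf.subset h)
          have h3 := hf.mem_in y
          have h4 := hf.le y
          grind
        · refine ih K hstuck ?_ f g₀ hf hg₀ y hy
          rw [hx, List.length_cons]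
          omega

/-- If left-greedy fails, then right-greedy never lets more elements enter the stacks. -/
theorem input_length_le_of_leftMove_eq_none (hp : IsPermOf n p) {K : ℕ}
    (hfail : leftMove t ((greedyStep leftMove t)^[K] (initConf t p)) = none) (k : ℕ) :
    ((greedyStep leftMove t)^[K] (initConf t p)).input.length ≤
      ((greedyStep rightMove t)^[k] (initConf t p)).input.length := by
  obtain ⟨f, hf, -⟩ := selectsLegal_leftMove.exists_hasPos_iterate (HasPos.initConf (t := t) hp) K
  induction k with
  | zero => exact hf.suffix.length_le
  | succ k ih =>
    obtain ⟨g, hg, -⟩ := selectsLegal_rightMove.exists_hasPos_iterate (HasPos.initConf (t := t) hp) k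
    have hle := leftGreedy_pos_le hp k K (fun m hm => leftMove_eq_none hfail hm.le) ih f g hf hg
    rw [Function.iterate_succ_apply']
    rcases selectsLegal_rightMove.greedyStep_input (t := t)
      ((greedyStep rightMove t)^[k] (initConf t p)) with h1 | ⟨h1, h2⟩
    · omega
    · rcases ih.lt_or_eq with hlt | heq
      · omega
      · exfalso
        have hin := (hf.input_suffix hg ih).eq_of_length heq
        have hlegal := (rightMove_eq_some h1).2.1
        have ht := hg.pos_of_legal le_rfl hlegal
        obtain ⟨x, s, hx, hpush⟩ := (hg.legal_input_iff ht).1 hlegal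
        have hl := leftMove_eq_none hfail le_rfl
        rw [← Bool.not_eq_true, hf.legal_input_iff ht] at hl
        refine hl ⟨x, s, hin.trans hx, fun y hy hfy => hpush y hy ?_⟩
        have h3 := hle y hy
        have h4 := hg.le y
        have h5 := hf.mem_in y
        have h6 := hg.mem_in y
        rw [hin] at h5
        grind

end Comparison

/-- During the left-greedy run, whenever a new element is about to enter the stacks,
every element all of whose smaller elements have already entered is already in the
output; consequently at corresponding critical moments no element has left the stacks
under the right-greedy algorithm without having left under the left-greedy algorithm. -/
theorem stmt18 (t n : ℕ) (p : List ℕ) (hp : IsPermOf n p) :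
    (∀ k : ℕ,
      leftMove t ((greedyStep leftMove t)^[k] (initConf t p)) = some t →
      ∀ x ∈ p, x ∉ ((greedyStep leftMove t)^[k] (initConf t p)).input →
        (∀ y ∈ p, y < x → y ∉ ((greedyStep leftMove t)^[k] (initConf t p)).input) →
        x ∈ ((greedyStep leftMove t)^[k] (initConf t p)).output) ∧
    (∀ i, 1 ≤ i → i ≤ n → ∀ cL cR : Conf, CritConf leftMove t i n p cL →
      CritConf rightMove t i n p cR → ∀ x ∈ cR.output, x ∈ cL.output) := by
  constructor
  · intro k hleft x hx hxin hsmall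
    obtain ⟨f, hf, -⟩ := selectsLegal_leftMove.exists_hasPos_iterate (HasPos.initConf (t := t) hp) k
    have hle : ∀ y ∈ p, y ∉ ((greedyStep leftMove t)^[k] (initConf t p)).input → f y ≤ t := by
      intro y hy hyin
      have h1 := hf.le y
      have h2 := hf.mem_in y
      grind
    refine (hf.mem_out x).2 ⟨hx, ?_⟩
    by_contra h0
    obtain ⟨m, -, hm, hlegal⟩ := hf.exists_legal hx (Nat.pos_of_ne_zero h0) (hle x hx hxin)
      (by omega) (fun _ z hz hzx => hle z hz (hsmall z hz hzx))
    simp [(leftMove_eq_some hleft).2.2 m hm] at hlegal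
  · rintro i hi hin _ _ ⟨K, rfl, hcL, -⟩ ⟨k, rfl, hcR, hfirst⟩ x hx
    obtain ⟨f, hf, -⟩ := selectsLegal_leftMove.exists_hasPos_iterate (HasPos.initConf (t := t) hp) K
    obtain ⟨g, hg, -⟩ := selectsLegal_rightMove.exists_hasPos_iterate (HasPos.initConf (t := t) hp) k
    have hplen : p.length = n := by rw [List.Perm.length_eq hp, List.length_range']
    have hstuck : ∀ m < t, legal t ((greedyStep leftMove t)^[K] (initConf t p)) m = false := by
      intro m hm
      rcases hcL with ⟨-, h⟩ | ⟨h, -⟩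
      · exact (leftMove_eq_some h).2.2 m hm
      · exact leftMove_eq_none h hm.le
    have hlen : ((greedyStep leftMove t)^[K] (initConf t p)).input.length ≤
        ((greedyStep rightMove t)^[k] (initConf t p)).input.length := by
      rcases hcL with ⟨h, -⟩ | ⟨h, -⟩
      · by_contra hlt
        obtain ⟨k', hk', h1, h2⟩ := selectsLegal_rightMove.exists_entry hf.suffix.length_le
          (not_le.1 hlt)
        exact hfirst k' hk' (Or.inl ⟨by omega, h2⟩)
      · exact input_length_le_of_leftMove_eq_none hp h k
    obtain ⟨hxp, hgx⟩ := (hg.mem_out x).1 hx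
    have := leftGreedy_pos_le hp k K hstuck hlen f g hf hg x hxp
    exact (hf.mem_out x).2 ⟨hxp, by omega⟩
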